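/- arXiv:0904.2557 — 9 statements merged into one kernel-verified Lean document; each statement's English description precedes it below -/
import Mathlib

section
/- No-Cloning Theorem: Let H be a complex inner product space with 2 ≤ dim H < ∞. There is no linear map L : H → H ⊗ H such that L ψ = ψ ⊗ ψ for every unit vector ψ ∈ H. (In particular, there is no quantum operation cloning an arbitrary quantum state.) -/
/-- **No-Cloning Theorem.** Let `H` be a finite-dimensional complex inner product space with
`2 ≤ dim H`.  There is no linear map `L : H → H ⊗ H` such that `L ψ = ψ ⊗ ψ` for every
unit vector `ψ ∈ H`. -/
theorem no_cloning (H : Type*) [NormedAddCommGroup H] [InnerProductSpace ℂ H]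
    [FiniteDimensional ℂ H] (hdim : 2 ≤ Module.finrank ℂ H) :
    ¬ ∃ L : H →ₗ[ℂ] TensorProduct ℂ H H,
        ∀ ψ : H, ‖ψ‖ = 1 → L ψ = TensorProduct.tmul ℂ ψ ψ := by
  rintro ⟨L, hL⟩
  have : Nontrivial H := Module.nontrivial_of_finrank_pos (R := ℂ) (by lia)
  obtain ⟨v, hv⟩ := exists_ne (0 : H)
  obtain ⟨ψ, hψ⟩ : ∃ ψ : H, ‖ψ‖ = 1 := ⟨_, norm_smul_inv_norm (𝕜 := ℂ) hv⟩
  have hneg : -(TensorProduct.tmul ℂ ψ ψ) = TensorProduct.tmul ℂ ψ ψ := by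
    simpa [hL ψ hψ, TensorProduct.neg_tmul, TensorProduct.tmul_neg] using
      hL (-ψ) (by rwa [norm_neg])
  have hnorm : ‖TensorProduct.tmul ℂ ψ ψ‖ = 1 := by
    rw [TensorProduct.norm_tmul, hψ, one_mul]
  have hzero : TensorProduct.tmul ℂ ψ ψ = 0 := by
    have : IsAddTorsionFree (TensorProduct ℂ H H) := .of_isTorsionFree ℂ _
    exact neg_eq_self.mp hneg
  simp [hzero] at hnorm
end

section
/- Linearity of quantum error correction: Let C be a subspace of ℂ^N, let A, B ∈ M_N(ℂ), and let (R_k)_{k ∈ Fin m} be matrices in M_N(ℂ) with ∑_k R_k† R_k = 1. Suppose that for each E ∈ {A, B} and every ψ ∈ C there is a scalar λ ≥ 0 with ∑_k (R_k E) |ψ⟩⟨ψ| (R_k E)† = λ |ψ⟩⟨ψ|. Then for all α, β ∈ ℂ, the same holds for E = αA + βB: for every ψ ∈ C there is λ ≥ 0 with ∑_k (R_k E) |ψ⟩⟨ψ| (R_k E)† = λ |ψ⟩⟨ψ|. That is, a code (together with a fixed recovery operation) that corrects errors A and B also corrects any linear combination of A and B. -/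
open Matrix

/-- A recovery operation `(R k)` (with `∑ k, (R k)ᴴ * R k = 1`) corrects the error `E`
on the code subspace `C` if for every `ψ ∈ C` the output state
`∑ k, (R k * E) |ψ⟩⟨ψ| (R k * E)ᴴ` is a nonnegative multiple of `|ψ⟩⟨ψ|`. -/
def Corrects {N m : ℕ} (R : Fin m → Matrix (Fin N) (Fin N) ℂ)
    (C : Submodule ℂ (Fin N → ℂ)) (E : Matrix (Fin N) (Fin N) ℂ) : Prop :=
  ∀ ψ ∈ C, ∃ lam : ℝ, 0 ≤ lam ∧
    ∑ k, (R k * E) * Matrix.vecMulVec ψ (star ψ) * (R k * E)ᴴ =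
      (lam : ℂ) • Matrix.vecMulVec ψ (star ψ)

theorem mul_vecMulVec_star_mul_conjTranspose {m n : Type*} [Fintype n]
    (M : Matrix m n ℂ) (ψ : n → ℂ) :
    M * vecMulVec ψ (star ψ) * Mᴴ = vecMulVec (M *ᵥ ψ) (star (M *ᵥ ψ)) := by
  rw [mul_vecMulVec, vecMulVec_mul, star_mulVec]

/-- If `∑ i, |v i⟩⟨v i|` is a multiple of `|ψ⟩⟨ψ|`, then a vector orthogonal to `ψ` is orthogonal
to every `v i`. -/
theorem star_dotProduct_eq_zero_of_sum_vecMulVec_star_eq {ι n : Type*} [Fintype ι] [Fintype n]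
    {v : ι → n → ℂ} {ψ : n → ℂ} {c : ℂ}
    (h : ∑ i, vecMulVec (v i) (star (v i)) = c • vecMulVec ψ (star ψ))
    {φ : n → ℂ} (hφ : star ψ ⬝ᵥ φ = 0) (i : ι) : star φ ⬝ᵥ v i = 0 := by
  have key := congrArg (fun M => star φ ⬝ᵥ (M *ᵥ φ)) h
  simp only [sum_mulVec, smul_mulVec, vecMulVec_mulVec, hφ, dotProduct_sum, dotProduct_smul,
    MulOpposite.op_zero, zero_smul, dotProduct_zero, smul_zero] at key
  have hterm (j : ι) : MulOpposite.op (star (v j) ⬝ᵥ φ) • (star φ ⬝ᵥ v j) =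
      (Complex.normSq (star φ ⬝ᵥ v j) : ℂ) := by
    rw [star_dotProduct, op_smul_eq_mul, Complex.normSq_eq_conj_mul_self,
      starRingEnd_apply, mul_comm]
  simp only [hterm] at key
  rw [← Complex.ofReal_sum, Complex.ofReal_eq_zero,
    Finset.sum_eq_zero_iff_of_nonneg fun _ _ => Complex.normSq_nonneg _] at key
  exact Complex.normSq_eq_zero.mp (key i (Finset.mem_univ i))

/-- If `∑ i, |v i⟩⟨v i|` is a multiple of `|ψ⟩⟨ψ|`, then every `v i` is a multiple of `ψ`. -/
theorem exists_eq_smul_of_sum_vecMulVec_star_eq {ι n : Type*} [Fintype ι] [Fintype n]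
    {v : ι → n → ℂ} {ψ : n → ℂ} {c : ℂ}
    (h : ∑ i, vecMulVec (v i) (star (v i)) = c • vecMulVec ψ (star ψ)) (i : ι) :
    ∃ a : ℂ, v i = a • ψ := by
  open scoped ComplexOrder in
  set a := (star ψ ⬝ᵥ v i) / (star ψ ⬝ᵥ ψ) with ha
  have hψ : star ψ ⬝ᵥ (v i - a • ψ) = 0 := by
    rw [dotProduct_sub, dotProduct_smul, smul_eq_mul, sub_eq_zero, ha]
    by_cases h0 : ψ = 0
    · simp [h0]
    · rw [div_mul_cancel₀ _ (mt dotProduct_star_self_eq_zero.mp h0)]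
  have hv := star_dotProduct_eq_zero_of_sum_vecMulVec_star_eq h hψ i
  have hψ' : star (v i - a • ψ) ⬝ᵥ ψ = 0 := by
    rw [star_dotProduct, hψ, star_zero]
  refine ⟨a, sub_eq_zero.mp (dotProduct_star_self_eq_zero.mp ?_)⟩
  rw [dotProduct_sub, dotProduct_smul, hv, hψ', smul_zero, sub_zero]

/-- **Linearity of quantum error correction.**  A code, together with a fixed recovery
operation, that corrects errors `A` and `B` also corrects any linear combination
`α • A + β • B` of `A` and `B`. -/
theorem corrects_linear_combination (N m : ℕ) (C : Submodule ℂ (Fin N → ℂ))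
    (A B : Matrix (Fin N) (Fin N) ℂ) (R : Fin m → Matrix (Fin N) (Fin N) ℂ)
    (hR : ∑ k, (R k)ᴴ * R k = 1)
    (hA : Corrects R C A) (hB : Corrects R C B) (α β : ℂ) :
    Corrects R C (α • A + β • B) := by
  intro ψ hψ
  obtain ⟨a, -, ha⟩ := hA ψ hψ
  obtain ⟨b, -, hb⟩ := hB ψ hψ
  simp only [mul_vecMulVec_star_mul_conjTranspose] at ha hb ⊢
  choose c hc using exists_eq_smul_of_sum_vecMulVec_star_eq ha
  choose d hd using exists_eq_smul_of_sum_vecMulVec_star_eq hb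
  refine ⟨∑ k, Complex.normSq (α * c k + β * d k),
    Finset.sum_nonneg fun _ _ => Complex.normSq_nonneg _, ?_⟩
  rw [Complex.ofReal_sum, Finset.sum_smul]
  refine Finset.sum_congr rfl fun k _ => ?_
  have h : (R k * (α • A + β • B)) *ᵥ ψ = (α * c k + β * d k) • ψ := by
    rw [mul_add, Matrix.mul_smul, Matrix.mul_smul, add_mulVec, smul_mulVec, smul_mulVec,
      hc, hd, smul_smul, smul_smul, add_smul]
  rw [h, star_smul, smul_vecMulVec, vecMulVec_smul, smul_smul, Complex.normSq_eq_conj_mul_self,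
    mul_comm, starRingEnd_apply]
end

section
/- Sufficiency of the quantum error-correction conditions (Knill–Laflamme, sufficiency direction): Let C be a subspace of ℂ^N and let 𝓔 be a ℂ-linear subspace of M_N(ℂ). Suppose that for every E, F ∈ 𝓔 there is a constant c(E,F) ∈ ℂ such that ⟪E ψ, F φ⟫ = c(E,F) · ⟪ψ, φ⟫ for all ψ, φ ∈ C. Then there exists a finite family of matrices (R_k) in M_N(ℂ) with ∑_k R_k† R_k = 1 such that for every E ∈ 𝓔 and every ψ ∈ C, ∑_k (R_k E) |ψ⟩⟨ψ| (R_k E)† = c(E,E) |ψ⟩⟨ψ|. That is, C is a quantum error-correcting code correcting the errors in 𝓔. -/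
open Matrix

/-- Every subspace of `ℂ^N` has a finite orthonormal basis. -/
lemma exists_orthonormal_family {N : ℕ} (W : Submodule ℂ (Fin N → ℂ)) :
    ∃ (d : ℕ) (b : Fin d → (Fin N → ℂ)), (∀ i, b i ∈ W) ∧
      (∀ i j, star (b i) ⬝ᵥ b j = if i = j then 1 else 0) ∧
      ∀ x ∈ W, ∑ i, (star (b i) ⬝ᵥ x) • b i = x := by
  let e := (WithLp.linearEquiv 2 ℂ (Fin N → ℂ)).symm
  let W' : Submodule ℂ (EuclideanSpace ℂ (Fin N)) := W.map e.toLinearMap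
  let b := stdOrthonormalBasis ℂ W'
  have hin (x y : EuclideanSpace ℂ (Fin N)) : inner ℂ x y = star x.ofLp ⬝ᵥ y.ofLp := by
    rw [EuclideanSpace.inner_eq_star_dotProduct, dotProduct_comm]
  refine ⟨_, fun i => (b i : EuclideanSpace ℂ (Fin N)).ofLp, fun i => ?_, fun i j => ?_,
    fun x hx => ?_⟩
  · obtain ⟨y, hy, h⟩ := (b i).2
    simpa [← h, e] using hy
  · rw [← hin, ← Submodule.coe_inner]
    exact orthonormal_iff_ite.mp b.orthonormal i j
  · have h := congrArg (fun y : W' => (y : EuclideanSpace ℂ (Fin N)).ofLp)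
      (b.sum_repr' ⟨e x, x, hx, rfl⟩)
    simpa [hin, e] using h

/-- Every subspace of `ℂ^N` is the range of a self-adjoint idempotent matrix. -/
lemma exists_orthogonal_projection_matrix {N : ℕ} (C : Submodule ℂ (Fin N → ℂ)) :
    ∃ P : Matrix (Fin N) (Fin N) ℂ, Pᴴ = P ∧ (∀ x, P *ᵥ x ∈ C) ∧ ∀ x ∈ C, P *ᵥ x = x := by
  obtain ⟨d, b, hb, -, hsum⟩ := exists_orthonormal_family C
  have hP (x) : (∑ i, vecMulVec (b i) (star (b i))) *ᵥ x = ∑ i, (star (b i) ⬝ᵥ x) • b i := by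
    simp [sum_mulVec, vecMulVec_mulVec]
  refine ⟨∑ i, vecMulVec (b i) (star (b i)), ?_, fun x => ?_, fun x hx => ?_⟩
  · simp [conjTranspose_sum, conjTranspose_vecMulVec]
  · rw [hP]
    exact C.sum_mem fun i _ => C.smul_mem _ (hb i)
  · rw [hP, hsum x hx]

/-- The Knill–Laflamme condition, compressed to the code subspace. -/
lemma projection_mul_conjTranspose_mul_mul_projection {N : ℕ} {C : Submodule ℂ (Fin N → ℂ)}
    {P E F : Matrix (Fin N) (Fin N) ℂ} {a : ℂ} (hPadj : Pᴴ = P) (hPC : ∀ x, P *ᵥ x ∈ C)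
    (hPid : ∀ x ∈ C, P *ᵥ x = x)
    (h : ∀ ψ ∈ C, ∀ φ ∈ C, star (E *ᵥ ψ) ⬝ᵥ F *ᵥ φ = a * (star ψ ⬝ᵥ φ)) :
    P * Eᴴ * F * P = a • P := by
  refine ext_of_mulVec_single fun j => dotProduct_eq _ _ fun y => ?_
  rw [dotProduct_comm, dotProduct_comm _ y]
  have key (x z : Fin N → ℂ) : star x ⬝ᵥ (P * Eᴴ * F * P) *ᵥ z = star x ⬝ᵥ (a • P) *ᵥ z := by
    have h1 := h _ (hPC x) _ (hPC z)
    rw [star_mulVec, star_mulVec, hPadj] at h1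
    simp only [← dotProduct_mulVec, hPid _ (hPC z)] at h1
    simpa only [smul_mulVec, dotProduct_smul, smul_eq_mul, ← mulVec_mulVec] using h1
  simpa using key (star y) (Pi.single j 1)

open scoped ComplexOrder in
/-- A linear space of errors satisfying the Knill–Laflamme conditions on a code subspace has a
finite family, orthonormal for `c`, which spans its action on the code subspace. -/
lemma exists_orthonormal_errors {N : ℕ} {C : Submodule ℂ (Fin N → ℂ)}
    {𝓔 : Submodule ℂ (Matrix (Fin N) (Fin N) ℂ)}
    {c : Matrix (Fin N) (Fin N) ℂ → Matrix (Fin N) (Fin N) ℂ → ℂ}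
    (hc : ∀ E ∈ 𝓔, ∀ F ∈ 𝓔, ∀ ψ ∈ C, ∀ φ ∈ C,
      star (E *ᵥ ψ) ⬝ᵥ F *ᵥ φ = c E F * (star ψ ⬝ᵥ φ))
    {ψ₀ : Fin N → ℂ} (hψ₀ : ψ₀ ∈ C) (hnorm : star ψ₀ ⬝ᵥ ψ₀ = 1) :
    ∃ (r : ℕ) (A : Fin r → Matrix (Fin N) (Fin N) ℂ), (∀ i, A i ∈ 𝓔) ∧
      (∀ i j, c (A i) (A j) = if i = j then 1 else 0) ∧
      (∀ E ∈ 𝓔, ∀ ψ ∈ C, ∑ i, c (A i) E • A i *ᵥ ψ = E *ᵥ ψ) ∧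
      ∀ E ∈ 𝓔, ∑ i, star (c (A i) E) * c (A i) E = c E E := by
  have hc₀ {E F} (hE : E ∈ 𝓔) (hF : F ∈ 𝓔) : c E F = star (E *ᵥ ψ₀) ⬝ᵥ F *ᵥ ψ₀ := by
    rw [hc E hE F hF _ hψ₀ _ hψ₀, hnorm, mul_one]
  obtain ⟨r, b, hb, horth, hsum⟩ :=
    exists_orthonormal_family (𝓔.map ((mulVecBilin ℂ ℂ).flip ψ₀))
  choose A hA hAb using hb
  replace hAb (i) : A i *ᵥ ψ₀ = b i := hAb i
  have hexp {E} (hE : E ∈ 𝓔) : ∑ i, c (A i) E • b i = E *ᵥ ψ₀ := by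
    simpa only [hc₀ (hA _) hE, hAb] using hsum (E *ᵥ ψ₀) ⟨E, hE, rfl⟩
  refine ⟨r, A, hA, fun i j => ?_, fun E hE ψ hψ => ?_, fun E hE => ?_⟩
  · rw [hc₀ (hA i) (hA j), hAb, hAb, horth]
  · let D := E - ∑ i, c (A i) E • A i
    have hD : D ∈ 𝓔 := 𝓔.sub_mem hE (𝓔.sum_mem fun i _ => 𝓔.smul_mem _ (hA i))
    have happ (φ) : D *ᵥ φ = E *ᵥ φ - ∑ i, c (A i) E • A i *ᵥ φ := by
      simp [D, sub_mulVec, sum_mulVec, smul_mulVec]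
    have hD₀ : D *ᵥ ψ₀ = 0 := by simp only [happ, hAb, hexp hE, sub_self]
    have hDψ : D *ᵥ ψ = 0 := by
      rw [← dotProduct_star_self_eq_zero, hc D hD D hD ψ hψ ψ hψ,
        hc₀ hD hD, hD₀]
      simp
    rw [happ, sub_eq_zero] at hDψ
    exact hDψ.symm
  · have h := hc₀ hE hE
    nth_rw 2 [← hexp hE] at h
    rw [h, dotProduct_sum]
    refine Finset.sum_congr rfl fun i _ => ?_
    rw [dotProduct_smul, smul_eq_mul, mul_comm, hc₀ (hA i) hE, hAb, star_dotProduct (E *ᵥ ψ₀)]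

/-- **Knill–Laflamme conditions, sufficiency direction.**  If for all errors `E, F` in a
linear space `𝓔` of errors we have `⟪E ψ, F φ⟫ = c(E,F) ⟪ψ, φ⟫` for all `ψ, φ` in the code
subspace `C`, then there is a recovery operation `(R k)` (a finite family of matrices with
`∑ k, (R k)ᴴ * R k = 1`) which corrects every error in `𝓔`:
`∑ k, (R k * E) |ψ⟩⟨ψ| (R k * E)ᴴ = c(E,E) |ψ⟩⟨ψ|` for every `E ∈ 𝓔` and `ψ ∈ C`. -/
theorem knill_laflamme_sufficiency (N : ℕ) (C : Submodule ℂ (Fin N → ℂ))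
    (𝓔 : Submodule ℂ (Matrix (Fin N) (Fin N) ℂ))
    (c : Matrix (Fin N) (Fin N) ℂ → Matrix (Fin N) (Fin N) ℂ → ℂ)
    (hc : ∀ E ∈ 𝓔, ∀ F ∈ 𝓔, ∀ ψ ∈ C, ∀ φ ∈ C,
      star (E.mulVec ψ) ⬝ᵥ F.mulVec φ = c E F * (star ψ ⬝ᵥ φ)) :
    ∃ (m : ℕ) (R : Fin m → Matrix (Fin N) (Fin N) ℂ),
      (∑ k, (R k)ᴴ * R k = 1) ∧
      ∀ E ∈ 𝓔, ∀ ψ ∈ C,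
        ∑ k, (R k * E) * Matrix.vecMulVec ψ (star ψ) * (R k * E)ᴴ =
          c E E • Matrix.vecMulVec ψ (star ψ) := by
  obtain ⟨d, b, hbC, hborth, hbsum⟩ := exists_orthonormal_family C
  cases d with
  | zero =>
    refine ⟨1, fun _ => 1, by simp, fun E _ ψ hψ => ?_⟩
    have hψ0 : ψ = 0 := by simpa using (hbsum ψ hψ).symm
    simp [hψ0]
  | succ d =>
  obtain ⟨r, A, hA, horth, hspan, hnorm⟩ :=
    exists_orthonormal_errors hc (hbC 0) ((hborth 0 0).trans (if_pos rfl))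
  obtain ⟨P, hPadj, hPC, hPid⟩ := exists_orthogonal_projection_matrix C
  have hPP : P * P = P := ext_of_mulVec_single fun j => by
    rw [← mulVec_mulVec, hPid _ (hPC _)]
  have hcomp {E F} (hE : E ∈ 𝓔) (hF : F ∈ 𝓔) : P * Eᴴ * F * P = c E F • P :=
    projection_mul_conjTranspose_mul_mul_projection hPadj hPC hPid (hc E hE F hF)
  let Q := ∑ i, A i * P * (A i)ᴴ
  have hQadj : Qᴴ = Q := by
    simp [Q, conjTranspose_sum, hPadj, Matrix.mul_assoc]
  have hQQ : Q * Q = Q := by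
    have hterm (i j) : A i * P * (A i)ᴴ * (A j * P * (A j)ᴴ) =
        if i = j then A i * P * (A i)ᴴ else 0 := by
      calc A i * P * (A i)ᴴ * (A j * P * (A j)ᴴ)
          = A i * (P * (A i)ᴴ * A j * P) * (A j)ᴴ := by simp only [Matrix.mul_assoc]
        _ = _ := by
          rw [hcomp (hA i) (hA j), horth]
          split_ifs with hij
          · simp [hij]
          · simp
    simp [Q, Finset.sum_mul_sum, hterm]
  have hrec {E ψ} (hE : E ∈ 𝓔) (hψ : ψ ∈ C) (i) :
      (P * (A i)ᴴ * E) *ᵥ ψ = c (A i) E • ψ := by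
    rw [← hPid ψ hψ, mulVec_mulVec, hcomp (hA i) hE, smul_mulVec]
  have hQE {E ψ} (hE : E ∈ 𝓔) (hψ : ψ ∈ C) : (Q * E) *ᵥ ψ = E *ᵥ ψ := by
    rw [← hspan E hE ψ hψ, Finset.sum_mul, sum_mulVec]
    refine Finset.sum_congr rfl fun i _ => ?_
    rw [Matrix.mul_assoc (A i), Matrix.mul_assoc (A i), ← mulVec_mulVec, hrec hE hψ,
      mulVec_smul]
  have hrank (M : Matrix (Fin N) (Fin N) ℂ) (ψ : Fin N → ℂ) :
      M * vecMulVec ψ (star ψ) * Mᴴ = vecMulVec (M *ᵥ ψ) (star (M *ᵥ ψ)) := by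
    rw [mul_vecMulVec, vecMulVec_mul, star_mulVec]
  refine ⟨r + 1, Fin.cons (1 - Q) fun i => P * (A i)ᴴ, ?_, fun E hE ψ hψ => ?_⟩
  · have hsum : ∑ i, (P * (A i)ᴴ)ᴴ * (P * (A i)ᴴ) = Q := by
      refine Finset.sum_congr rfl fun i _ => ?_
      rw [conjTranspose_mul, conjTranspose_conjTranspose, hPadj, ← Matrix.mul_assoc,
        Matrix.mul_assoc (A i) P P, hPP]
    simp only [Fin.sum_univ_succ, Fin.cons_zero, Fin.cons_succ, hsum, conjTranspose_sub,
      conjTranspose_one, hQadj]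
    rw [sub_mul, mul_sub, mul_sub, hQQ]
    simp
  · have h0 : ((1 - Q) * E) *ᵥ ψ = 0 := by
      rw [sub_mul, one_mul, sub_mulVec, hQE hE hψ, sub_self]
    simp only [Fin.sum_univ_succ, Fin.cons_zero, Fin.cons_succ, hrank, h0, hrec hE hψ,
      zero_vecMulVec, zero_add, star_smul, smul_vecMulVec, vecMulVec_smul, smul_smul,
      ← Finset.sum_smul, hnorm E hE]
end

section
/- Necessity of the quantum error-correction conditions (Knill–Laflamme, necessity direction): Let C be a subspace of ℂ^N, let E ∈ M_N(ℂ), and let (R_k)_{k ∈ Fin m} be matrices with ∑_k R_k† R_k = 1 such that for every ψ ∈ C there is a scalar λ(ψ) ≥ 0 with ∑_k (R_k E) |ψ⟩⟨ψ| (R_k E)† = λ(ψ) |ψ⟩⟨ψ|. Then ⟪ψ, E† E ψ⟫ = ⟪φ, E† E φ⟫ for all unit vectors ψ, φ ∈ C; i.e. the value ⟪ψ, E† E ψ⟫ is independent of the unit vector ψ ∈ C. -/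
open Matrix

open scoped ComplexOrder in
/-- If a sum of rank-one matrices `|v k⟩⟨v k|` is a multiple of `|ψ⟩⟨ψ|`, then each `v k` is a
multiple of `ψ`. -/
theorem exists_eq_smul_of_sum_vecMulVec_star {ι n : Type*} [Fintype ι] [Fintype n]
    (v : ι → n → ℂ) (ψ : n → ℂ) (a : ℂ)
    (h : ∑ k, vecMulVec (v k) (star (v k)) = a • vecMulVec ψ (star ψ)) (k : ι) :
    ∃ c : ℂ, v k = c • ψ := by
  refine ⟨(star ψ ⬝ᵥ v k) / (star ψ ⬝ᵥ ψ), ?_⟩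
  set x := v k - ((star ψ ⬝ᵥ v k) / (star ψ ⬝ᵥ ψ)) • ψ with hx
  have hψx : star ψ ⬝ᵥ x = 0 := by
    rw [hx, dotProduct_sub, dotProduct_smul, smul_eq_mul]
    by_cases hψ : star ψ ⬝ᵥ ψ = 0
    · simp [dotProduct_star_self_eq_zero.1 hψ]
    · rw [div_mul_cancel₀ _ hψ, sub_self]
  have hsum : ∑ j, star (star (v j) ⬝ᵥ x) * (star (v j) ⬝ᵥ x) = 0 := by
    have h' := congrArg (fun M => star x ⬝ᵥ M *ᵥ x) h
    simp only [sum_mulVec, smul_mulVec, vecMulVec_mulVec, hψx, dotProduct_sum] at h'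
    have hstar : ∀ j, star x ⬝ᵥ v j = star (star (v j) ⬝ᵥ x) :=
      fun j => star_dotProduct _ _
    simpa [hstar, mul_comm] using h'
  have hvx : star (v k) ⬝ᵥ x = 0 := by
    have h0 := (Finset.sum_eq_zero_iff_of_nonneg (fun j _ => star_mul_self_nonneg _)).1 hsum k
      (Finset.mem_univ k)
    simpa using h0
  have hxx : star x ⬝ᵥ x = 0 := by
    nth_rewrite 1 [hx]
    rw [star_sub, star_smul, sub_dotProduct, smul_dotProduct, hψx, hvx]
    simp
  exact sub_eq_zero.1 (dotProduct_star_self_eq_zero.1 hxx)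

/-- Two eigenvectors whose sum is also an eigenvector have the same eigenvalue. -/
theorem eigenvalue_eq_of_add_eigenvector {K V : Type*} [Field K] [AddCommGroup V] [Module K V]
    (f : V →ₗ[K] V) {x y : V} {a b c : K} (hx0 : x ≠ 0) (hy0 : y ≠ 0)
    (hx : f x = a • x) (hy : f y = b • y) (hxy : f (x + y) = c • (x + y)) : a = b := by
  have hlin : (a - c) • x = (c - b) • y := by
    rw [map_add, hx, hy] at hxy
    linear_combination (norm := module) hxy
  have hmul : ((a - c) * (a - b)) • x = 0 := by
    have hf := congrArg f hlin
    rw [map_smul, map_smul, hx, hy] at hf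
    linear_combination (norm := module) hf - b • hlin
  rcases mul_eq_zero.1 ((smul_eq_zero.1 hmul).resolve_right hx0) with hac | hab
  · rw [hac, zero_smul] at hlin
    have hcb := (smul_eq_zero.1 hlin.symm).resolve_right hy0
    linear_combination hac + hcb
  · exact sub_eq_zero.1 hab

/-- **Knill–Laflamme conditions, necessity direction.**  If a recovery operation `(R k)`
(with `∑ k, (R k)ᴴ * R k = 1`) corrects the error `E` on the code subspace `C`, i.e. for
every `ψ ∈ C` the output `∑ k, (R k * E) |ψ⟩⟨ψ| (R k * E)ᴴ` is a nonnegative multiple of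
`|ψ⟩⟨ψ|`, then `⟪ψ, Eᴴ E ψ⟫` is independent of the unit vector `ψ ∈ C`. -/
theorem knill_laflamme_necessity (N m : ℕ) (C : Submodule ℂ (Fin N → ℂ))
    (E : Matrix (Fin N) (Fin N) ℂ) (R : Fin m → Matrix (Fin N) (Fin N) ℂ)
    (hR : ∑ k, (R k)ᴴ * R k = 1)
    (hcorr : ∀ ψ ∈ C, ∃ lam : ℝ, 0 ≤ lam ∧
      ∑ k, (R k * E) * Matrix.vecMulVec ψ (star ψ) * (R k * E)ᴴ =
        (lam : ℂ) • Matrix.vecMulVec ψ (star ψ)) :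
    ∀ ψ ∈ C, ∀ φ ∈ C, star ψ ⬝ᵥ ψ = 1 → star φ ⬝ᵥ φ = 1 →
      star ψ ⬝ᵥ (Eᴴ * E).mulVec ψ = star φ ⬝ᵥ (Eᴴ * E).mulVec φ := by
  have heig : ∀ ψ ∈ C, ∀ k, ∃ c : ℂ, (R k * E) *ᵥ ψ = c • ψ := by
    intro ψ hψ
    obtain ⟨lam, -, h⟩ := hcorr ψ hψ
    refine exists_eq_smul_of_sum_vecMulVec_star (fun k => (R k * E) *ᵥ ψ) ψ lam ?_
    simpa only [mul_vecMulVec, vecMulVec_mul, ← star_mulVec] using h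
  have hnorm : ∀ ψ : Fin N → ℂ, star ψ ⬝ᵥ (Eᴴ * E) *ᵥ ψ =
      ∑ k, star ((R k * E) *ᵥ ψ) ⬝ᵥ (R k * E) *ᵥ ψ := by
    intro ψ
    have hE : Eᴴ * E = ∑ k, (R k * E)ᴴ * (R k * E) := by
      simp only [conjTranspose_mul, Matrix.mul_assoc]
      simp only [← Matrix.mul_sum, ← Matrix.mul_assoc (R _)ᴴ, ← Matrix.sum_mul, hR, Matrix.one_mul]
    simp only [hE, sum_mulVec, dotProduct_sum, star_mulVec, ← dotProduct_mulVec, mulVec_mulVec]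
  intro ψ hψ φ hφ hψ1 hφ1
  have hψ0 : ψ ≠ 0 := by
    rintro rfl
    simp at hψ1
  have hφ0 : φ ≠ 0 := by
    rintro rfl
    simp at hφ1
  rw [hnorm, hnorm]
  refine Finset.sum_congr rfl fun k _ => ?_
  obtain ⟨a, ha⟩ := heig ψ hψ k
  obtain ⟨b, hb⟩ := heig φ hφ k
  obtain ⟨c, hc⟩ := heig (ψ + φ) (C.add_mem hψ hφ) k
  have hab : a = b :=
    eigenvalue_eq_of_add_eigenvector (R k * E).mulVecLin hψ0 hφ0 ha hb hc
  simp only [ha, hb, hab, star_smul, smul_dotProduct, dotProduct_smul, hψ1, hφ1]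
end

section
/- Quantum Hamming bound: Let n, k, t be natural numbers, let C be a subspace of ℂ^{2^n} of dimension 2^k with orthonormal basis (ψ_i), and let (E_a)_{a ∈ Fin N} enumerate the N = ∑_{j=0}^{t} 3^j · binomial(n, j) n-qubit Pauli operators with c = 0 and weight at most t. Suppose the code is nondegenerate for these errors, i.e. there is an invertible N × N complex matrix (C_{ab}) such that ⟪E_a ψ_i, E_b ψ_j⟫ = C_{ab} · δ_{ij} for all a, b, i, j. Then (∑_{j=0}^{t} 3^j · binomial(n, j)) · 2^k ≤ 2^n. -/
open Matrix Finset

noncomputable section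

/-- The space of `2^n × 2^n` complex matrices, realized as matrices indexed by
`n`-bit strings (the `n`-fold Kronecker product of `M₂(ℂ)`). -/
abbrev MatN (n : ℕ) := Matrix (Fin n → Fin 2) (Fin n → Fin 2) ℂ

/-- The Pauli matrix `X`. -/
def PX : Matrix (Fin 2) (Fin 2) ℂ := !![0, 1; 1, 0]

/-- The Pauli matrix `Y`. -/
def PY : Matrix (Fin 2) (Fin 2) ℂ := !![0, -Complex.I; Complex.I, 0]

/-- The Pauli matrix `Z`. -/
def PZ : Matrix (Fin 2) (Fin 2) ℂ := !![1, 0; 0, -1]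

/-- A single-qubit Pauli matrix: one of `1, X, Y, Z`. -/
def IsSinglePauli (σ : Matrix (Fin 2) (Fin 2) ℂ) : Prop :=
  σ = 1 ∨ σ = PX ∨ σ = PY ∨ σ = PZ

/-- The Kronecker (tensor) product `σ₁ ⊗ ⋯ ⊗ σₙ` of single-qubit matrices, with entries
`(⊗ⱼ σⱼ) x y = ∏ⱼ (σⱼ) (x j) (y j)`. -/
def tensorPauli {n : ℕ} (σ : Fin n → Matrix (Fin 2) (Fin 2) ℂ) : MatN n :=
  Matrix.of fun x y => ∏ j, σ j (x j) (y j)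

/-- An `n`-qubit Pauli operator: `i^c • σ₁ ⊗ ⋯ ⊗ σₙ` with `c ∈ {0,1,2,3}` and each
`σⱼ ∈ {1, X, Y, Z}`. -/
def IsPauli (n : ℕ) (P : MatN n) : Prop :=
  ∃ (c : ℕ) (σ : Fin n → Matrix (Fin 2) (Fin 2) ℂ),
    c < 4 ∧ (∀ j, IsSinglePauli (σ j)) ∧ P = Complex.I ^ c • tensorPauli σ

/-- An `n`-qubit Pauli operator of weight at most `w`: at most `w` of the tensor factors
are different from the identity. -/
def IsPauliOfWeightLE (n w : ℕ) (P : MatN n) : Prop :=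
  ∃ (c : ℕ) (σ : Fin n → Matrix (Fin 2) (Fin 2) ℂ),
    c < 4 ∧ (∀ j, IsSinglePauli (σ j)) ∧ Nat.card {j // σ j ≠ 1} ≤ w ∧
      P = Complex.I ^ c • tensorPauli σ

/-- The weight of an `n`-qubit Pauli operator: the number of tensor factors which are not
the identity (defined as an infimum over representations). -/
def pauliWeight {n : ℕ} (P : MatN n) : ℕ :=
  sInf {w | ∃ (c : ℕ) (σ : Fin n → Matrix (Fin 2) (Fin 2) ℂ),
    c < 4 ∧ (∀ j, IsSinglePauli (σ j)) ∧ Nat.card {j // σ j ≠ 1} = w ∧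
      P = Complex.I ^ c • tensorPauli σ}

/-- The code space `T(S)` of a set `S` of matrices: the states fixed by every `M ∈ S`. -/
def codeSpace {n : ℕ} (S : Set (MatN n)) : Submodule ℂ ((Fin n → Fin 2) → ℂ) where
  carrier := {ψ | ∀ M ∈ S, M.mulVec ψ = ψ}
  add_mem' := by
    intro ψ φ hψ hφ M hM
    rw [Matrix.mulVec_add, hψ M hM, hφ M hM]
  zero_mem' := by
    intro M hM
    rw [Matrix.mulVec_zero]
  smul_mem' := by
    intro c ψ hψ M hM
    rw [Matrix.mulVec_smul, hψ M hM]

/-- An `[[n,k,d]]` quantum code: a subspace of `ℂ^{2^n}` of dimension `2^k` such that no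
`n`-qubit Pauli operator of weight at most `d−1` can distinguish codewords, i.e.
`⟪ψ, E ψ⟫` is constant over unit vectors `ψ` in the code. -/
def IsQuantumCode (n k d : ℕ) (C : Submodule ℂ ((Fin n → Fin 2) → ℂ)) : Prop :=
  Module.finrank ℂ C = 2 ^ k ∧
  ∀ E : MatN n, IsPauliOfWeightLE n (d - 1) E →
    ∃ cE : ℂ, ∀ ψ ∈ C, star ψ ⬝ᵥ ψ = 1 → star ψ ⬝ᵥ E.mulVec ψ = cE

/-- A finite family of vectors in `m → R` with invertible Gram matrix has at most
`Fintype.card m` members. -/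
theorem card_le_card_of_isUnit_gram {ι m R : Type*} [Fintype ι] [DecidableEq ι] [Fintype m]
    [Field R] [StarRing R] (v : ι → m → R)
    (h : IsUnit (Matrix.of fun a b => star (v a) ⬝ᵥ v b)) :
    Fintype.card ι ≤ Fintype.card m := by
  have hgram : (Matrix.of fun a b => star (v a) ⬝ᵥ v b) =
      (Matrix.of v).map star * (Matrix.of v)ᵀ := rfl
  rw [← Matrix.rank_of_isUnit _ h, hgram]
  exact (Matrix.rank_mul_le_right _ _).trans (Matrix.rank_le_card_height _)

/-- **Quantum Hamming bound.**  Suppose `C ⊆ ℂ^{2^n}` is a subspace of dimension `2^k`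
with orthonormal basis `(ψ i)`, and `(E a)` enumerates the `N = ∑_{j ≤ t} 3^j (n choose j)`
`n`-qubit Pauli operators with trivial phase and weight at most `t`.  If the code is
nondegenerate for these errors — `⟪E a ψ i, E b ψ j⟫ = C a b · δ_{ij}` with `(C a b)` an
invertible matrix — then `N * 2^k ≤ 2^n`. -/
theorem quantum_hamming_bound (n k t : ℕ)
    (C : Submodule ℂ ((Fin n → Fin 2) → ℂ))
    (hdim : Module.finrank ℂ C = 2 ^ k)
    (ψ : Fin (2 ^ k) → ((Fin n → Fin 2) → ℂ))
    (hmem : ∀ i, ψ i ∈ C)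
    (hON : ∀ i j, star (ψ i) ⬝ᵥ ψ j = if i = j then 1 else 0)
    (hspan : Submodule.span ℂ (Set.range ψ) = C)
    (E : Fin (∑ j ∈ Finset.range (t + 1), 3 ^ j * n.choose j) → MatN n)
    (hEinj : Function.Injective E)
    (hEPauli : ∀ a, ∃ σ : Fin n → Matrix (Fin 2) (Fin 2) ℂ,
      (∀ j, IsSinglePauli (σ j)) ∧ Nat.card {j // σ j ≠ 1} ≤ t ∧ E a = tensorPauli σ)
    (hEall : ∀ P : MatN n,
      (∃ σ : Fin n → Matrix (Fin 2) (Fin 2) ℂ,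
        (∀ j, IsSinglePauli (σ j)) ∧ Nat.card {j // σ j ≠ 1} ≤ t ∧ P = tensorPauli σ) →
      ∃ a, E a = P)
    (Cm : Matrix (Fin (∑ j ∈ Finset.range (t + 1), 3 ^ j * n.choose j))
                 (Fin (∑ j ∈ Finset.range (t + 1), 3 ^ j * n.choose j)) ℂ)
    (hCm : IsUnit Cm)
    (hnondeg : ∀ a b i j,
      star ((E a).mulVec (ψ i)) ⬝ᵥ (E b).mulVec (ψ j) = Cm a b * (if i = j then 1 else 0)) :
    (∑ j ∈ Finset.range (t + 1), 3 ^ j * n.choose j) * 2 ^ k ≤ 2 ^ n := by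
  have hgram : (Matrix.of fun p q => star ((E p.1).mulVec (ψ p.2)) ⬝ᵥ (E q.1).mulVec (ψ q.2)) =
      Matrix.kronecker Cm (1 : Matrix (Fin (2 ^ k)) (Fin (2 ^ k)) ℂ) := by
    ext p q
    simp [hnondeg, Matrix.one_apply]
  simpa using card_le_card_of_isUnit_gram
    (fun p : Fin _ × Fin (2 ^ k) => (E p.1).mulVec (ψ p.2))
    (hgram ▸ Matrix.IsUnit.kronecker hCm isUnit_one)

end
end

section
/- Quantum Gilbert–Varshamov bound: Let n, k, d be natural numbers with d ≥ 1 and (∑_{j=0}^{d−1} 3^j · binomial(n, j)) · 2^k ≤ 2^n. Then there exists an [[n,k,d]] quantum code C ⊆ ℂ^{2^n}. -/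
open Matrix Finset

noncomputable section

theorem Submodule.exists_le_finrank_eq {K V : Type*} [DivisionRing K] [AddCommGroup V] [Module K V]
    {C : Submodule K V} {m : ℕ} (hm : m ≤ Module.finrank K C) :
    ∃ D ≤ C, Module.finrank K D = m := by
  obtain ⟨f, hf⟩ := exists_linearIndependent_of_le_finrank hm
  refine ⟨Submodule.span K (Set.range fun i => (f i : V)), ?_, ?_⟩
  · rw [Submodule.span_le]
    rintro _ ⟨i, rfl⟩
    exact (f i).2
  · have hf' := hf.map' C.subtype C.ker_subtype
    exact (finrank_span_eq_card hf').trans (Fintype.card_fin m)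

/-- The single-qubit Pauli matrix labelled by a pair of bits (bit-flip part, phase-flip part). -/
def pauliMat (p : ZMod 2 × ZMod 2) : Matrix (Fin 2) (Fin 2) ℂ :=
  if p.1 = 0 then (if p.2 = 0 then 1 else PZ) else (if p.2 = 0 then PX else PY)

/-- The sign by which two single-qubit Pauli matrices commute. -/
def pauliSign (p q : ZMod 2 × ZMod 2) : ℂ :=
  if p.1 * q.2 + p.2 * q.1 = 0 then 1 else -1

theorem ZMod.two_prod_cases (p : ZMod 2 × ZMod 2) :
    p = (0, 0) ∨ p = (0, 1) ∨ p = (1, 0) ∨ p = (1, 1) := by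
  revert p; decide

theorem pauliMat_zero : pauliMat 0 = 1 := by simp [pauliMat]

theorem conjTranspose_pauliMat (p : ZMod 2 × ZMod 2) : (pauliMat p)ᴴ = pauliMat p := by
  rcases ZMod.two_prod_cases p with rfl | rfl | rfl | rfl <;> ext i j <;> fin_cases i <;>
    fin_cases j <;> simp [pauliMat, PX, PY, PZ]

theorem pauliMat_mul_self (p : ZMod 2 × ZMod 2) : pauliMat p * pauliMat p = 1 := by
  rcases ZMod.two_prod_cases p with rfl | rfl | rfl | rfl <;> ext i j <;> fin_cases i <;>
    fin_cases j <;> simp [pauliMat, PX, PY, PZ]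

theorem pauliMat_comm (p q : ZMod 2 × ZMod 2) :
    pauliMat p * pauliMat q = pauliSign p q • (pauliMat q * pauliMat p) := by
  have h2 : (1 + 1 : ZMod 2) = 0 := rfl
  rcases ZMod.two_prod_cases p with rfl | rfl | rfl | rfl <;>
    rcases ZMod.two_prod_cases q with rfl | rfl | rfl | rfl <;> ext i j <;> fin_cases i <;>
    fin_cases j <;> simp [pauliMat, PX, PY, PZ, pauliSign, h2]

theorem exists_pauliMat_add (p q : ZMod 2 × ZMod 2) :
    ∃ c : ℂ, pauliMat (p + q) = c • (pauliMat p * pauliMat q) := by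
  have h2 : (1 + 1 : ZMod 2) = 0 := rfl
  rcases ZMod.two_prod_cases p with rfl | rfl | rfl | rfl <;>
    rcases ZMod.two_prod_cases q with rfl | rfl | rfl | rfl <;>
    first
    | (refine ⟨1, ?_⟩; ext i j; fin_cases i <;> fin_cases j <;>
        simp [pauliMat, PX, PY, PZ, h2]; done)
    | (refine ⟨Complex.I, ?_⟩; ext i j; fin_cases i <;> fin_cases j <;>
        simp [pauliMat, PX, PY, PZ, h2]; done)
    | (refine ⟨-Complex.I, ?_⟩; ext i j; fin_cases i <;> fin_cases j <;>
        simp [pauliMat, PX, PY, PZ, h2])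

theorem pauliSign_add_left (p q r : ZMod 2 × ZMod 2) :
    pauliSign (p + q) r = pauliSign p r * pauliSign q r := by
  have h2 : (1 + 1 : ZMod 2) = 0 := rfl
  rcases ZMod.two_prod_cases p with rfl | rfl | rfl | rfl <;>
    rcases ZMod.two_prod_cases q with rfl | rfl | rfl | rfl <;>
    rcases ZMod.two_prod_cases r with rfl | rfl | rfl | rfl <;> simp [pauliSign, h2]

theorem pauliSign_comm (p q : ZMod 2 × ZMod 2) : pauliSign p q = pauliSign q p := by
  have : p.1 * q.2 + p.2 * q.1 = q.1 * p.2 + q.2 * p.1 := by ring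
  simp [pauliSign, this]

theorem exists_pauliSign_ne_one {p : ZMod 2 × ZMod 2} (hp : p ≠ 0) : ∃ q, pauliSign p q ≠ 1 := by
  have key : ∀ p : ZMod 2 × ZMod 2, p ≠ 0 → ∃ q : ZMod 2 × ZMod 2, p.1 * q.2 + p.2 * q.1 ≠ 0 := by
    decide
  obtain ⟨q, hq⟩ := key p hp
  refine ⟨q, ?_⟩
  norm_num [pauliSign, hq]

theorem tensorPauli_mul {n : ℕ} (σ τ : Fin n → Matrix (Fin 2) (Fin 2) ℂ) :
    tensorPauli σ * tensorPauli τ = tensorPauli fun j => σ j * τ j := by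
  ext x y
  simp only [tensorPauli, Matrix.mul_apply, Matrix.of_apply, Finset.prod_univ_sum,
    Fintype.piFinset_univ, Finset.prod_mul_distrib]

theorem tensorPauli_smul {n : ℕ} (c : Fin n → ℂ) (σ : Fin n → Matrix (Fin 2) (Fin 2) ℂ) :
    (tensorPauli fun j => c j • σ j) = (∏ j, c j) • tensorPauli σ := by
  ext x y
  simp [tensorPauli, Finset.prod_mul_distrib]

theorem tensorPauli_one {n : ℕ} : tensorPauli (fun _ : Fin n => 1) = 1 := by
  ext x y
  by_cases h : x = y
  · subst h
    simp [tensorPauli]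
  · obtain ⟨j, hj⟩ := Function.ne_iff.mp h
    rw [Matrix.one_apply_ne h]
    exact Finset.prod_eq_zero (Finset.mem_univ j) (Matrix.one_apply_ne hj)

theorem conjTranspose_tensorPauli {n : ℕ} (σ : Fin n → Matrix (Fin 2) (Fin 2) ℂ) :
    (tensorPauli σ)ᴴ = tensorPauli fun j => (σ j)ᴴ := by
  ext x y
  simp [tensorPauli, Matrix.conjTranspose_apply]

/-- The `n`-qubit Pauli operator labelled by a vector of pairs of bits. -/
def pauliOp {n : ℕ} (v : Fin n → ZMod 2 × ZMod 2) : MatN n :=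
  tensorPauli fun j => pauliMat (v j)

/-- The sign by which two `n`-qubit Pauli operators commute. -/
def commSign {n : ℕ} (u v : Fin n → ZMod 2 × ZMod 2) : ℂ :=
  ∏ j, pauliSign (u j) (v j)

section Labels

variable {n : ℕ}

theorem pauliOp_zero : pauliOp (0 : Fin n → ZMod 2 × ZMod 2) = 1 := by
  simp only [pauliOp, Pi.zero_apply, pauliMat_zero, tensorPauli_one]

theorem conjTranspose_pauliOp (v : Fin n → ZMod 2 × ZMod 2) : (pauliOp v)ᴴ = pauliOp v := by
  simp only [pauliOp, conjTranspose_tensorPauli, conjTranspose_pauliMat]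

theorem pauliOp_mul_self (v : Fin n → ZMod 2 × ZMod 2) : pauliOp v * pauliOp v = 1 := by
  simp only [pauliOp, tensorPauli_mul, pauliMat_mul_self, tensorPauli_one]

theorem pauliOp_comm (u v : Fin n → ZMod 2 × ZMod 2) :
    pauliOp u * pauliOp v = commSign u v • (pauliOp v * pauliOp u) := by
  simp only [pauliOp, tensorPauli_mul, commSign, ← tensorPauli_smul, ← pauliMat_comm]

theorem exists_pauliOp_add (u v : Fin n → ZMod 2 × ZMod 2) :
    ∃ c : ℂ, pauliOp (u + v) = c • (pauliOp u * pauliOp v) := by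
  choose c hc using fun j => exists_pauliMat_add (u j) (v j)
  refine ⟨∏ j, c j, ?_⟩
  simp only [pauliOp, tensorPauli_mul, ← tensorPauli_smul, ← hc, Pi.add_apply]

theorem commSign_add_left (u v w : Fin n → ZMod 2 × ZMod 2) :
    commSign (u + v) w = commSign u w * commSign v w := by
  simp only [commSign, Pi.add_apply, pauliSign_add_left, Finset.prod_mul_distrib]

theorem commSign_comm (u v : Fin n → ZMod 2 × ZMod 2) : commSign u v = commSign v u := by
  simp only [commSign, pauliSign_comm]

theorem commSign_add_right (u v w : Fin n → ZMod 2 × ZMod 2) :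
    commSign u (v + w) = commSign u v * commSign u w := by
  rw [commSign_comm, commSign_add_left, commSign_comm v, commSign_comm w]

theorem add_self_label (v : Fin n → ZMod 2 × ZMod 2) : v + v = 0 := by
  funext j
  exact (by decide : ∀ p : ZMod 2 × ZMod 2, p + p = 0) (v j)

theorem neg_label (v : Fin n → ZMod 2 × ZMod 2) : -v = v :=
  neg_eq_of_add_eq_zero_left (add_self_label v)

theorem commSign_zero_left (v : Fin n → ZMod 2 × ZMod 2) : commSign 0 v = 1 := by
  simp [commSign, pauliSign]

theorem commSign_eq_or (u v : Fin n → ZMod 2 × ZMod 2) : commSign u v = 1 ∨ commSign u v = -1 := by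
  rw [← mul_self_eq_one_iff, ← commSign_add_left, add_self_label, commSign_zero_left]

theorem eq_zero_of_commSign_eq_one {v : Fin n → ZMod 2 × ZMod 2}
    (h : ∀ u, commSign v u = 1) : v = 0 := by
  by_contra hv
  obtain ⟨j, hj⟩ := Function.ne_iff.mp hv
  obtain ⟨q, hq⟩ := exists_pauliSign_ne_one hj
  apply hq
  rw [← h (Pi.single j q), commSign, Finset.prod_eq_single j]
  · simp
  · intro i _ hi
    simp [hi, pauliSign]
  · simp

/-- The labels in `N` whose operators commute with every operator labelled by `N`. -/
def IsCentral (N : AddSubgroup (Fin n → ZMod 2 × ZMod 2)) (v : Fin n → ZMod 2 × ZMod 2) : Prop :=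
  v ∈ N ∧ ∀ u ∈ N, commSign v u = 1

/-- The labels in `N` whose operators commute with the one labelled by `g`. -/
def commutant (N : AddSubgroup (Fin n → ZMod 2 × ZMod 2)) (g : Fin n → ZMod 2 × ZMod 2) :
    AddSubgroup (Fin n → ZMod 2 × ZMod 2) where
  carrier := {v | v ∈ N ∧ commSign v g = 1}
  add_mem' := by
    rintro a b ⟨ha, ha'⟩ ⟨hb, hb'⟩
    exact ⟨N.add_mem ha hb, by rw [commSign_add_left, ha', hb', one_mul]⟩
  zero_mem' := ⟨N.zero_mem, commSign_zero_left g⟩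
  neg_mem' := by
    intro a ha
    rwa [neg_label]

theorem mem_commutant {N : AddSubgroup (Fin n → ZMod 2 × ZMod 2)}
    {g v : Fin n → ZMod 2 × ZMod 2} : v ∈ commutant N g ↔ v ∈ N ∧ commSign v g = 1 := Iff.rfl

theorem IsCentral.of_commutant {N : AddSubgroup (Fin n → ZMod 2 × ZMod 2)}
    {g v : Fin n → ZMod 2 × ZMod 2} (hg : g ∈ N) (hv : IsCentral (commutant N g) v) :
    IsCentral N v ∨ IsCentral N (v + g) := by
  obtain ⟨⟨hvN, hvg⟩, hvc⟩ := hv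
  by_cases hall : ∀ u ∈ N, commSign v u = 1
  · exact Or.inl ⟨hvN, hall⟩
  · push Not at hall
    obtain ⟨w, hwN, hw⟩ := hall
    have hneg : ∀ u ∈ N, commSign u g ≠ 1 → commSign v u = -1 := by
      intro u hu hug
      have hwg : commSign w g = -1 :=
        (commSign_eq_or w g).resolve_left fun h => hw (hvc w ⟨hwN, h⟩)
      have hu' : commSign u g = -1 := (commSign_eq_or u g).resolve_left hug
      have := hvc (w + u) ⟨N.add_mem hwN hu, by rw [commSign_add_left, hwg, hu']; norm_num⟩
      rw [commSign_add_right, (commSign_eq_or v w).resolve_left hw] at this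
      linear_combination -this
    refine Or.inr ⟨N.add_mem hvN hg, fun u hu => ?_⟩
    rw [commSign_add_left, commSign_comm g u]
    by_cases hug : commSign u g = 1
    · rw [hvc u ⟨hu, hug⟩, hug, one_mul]
    · rw [hneg u hu hug, (commSign_eq_or u g).resolve_left hug]
      norm_num

/-- The labels from `E` lying in `N` but not in its centre: the potentially harmful errors. -/
def badErrors (E : Finset (Fin n → ZMod 2 × ZMod 2))
    (N : AddSubgroup (Fin n → ZMod 2 × ZMod 2)) : Finset (Fin n → ZMod 2 × ZMod 2) :=
  open scoped Classical in {e ∈ E | e ∈ N ∧ ¬ IsCentral N e}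

theorem two_mul_card_commuting (N : AddSubgroup (Fin n → ZMod 2 × ZMod 2))
    {e h : Fin n → ZMod 2 × ZMod 2} (hh : h ∈ N) (heh : commSign e h ≠ 1) :
    open scoped Classical in 2 * #{g : Fin n → ZMod 2 × ZMod 2 | g ∈ N ∧ commSign e g = 1}
      = #{g : Fin n → ZMod 2 × ZMod 2 | g ∈ N} := by
  classical
  have heh' := (commSign_eq_or e h).resolve_left heh
  have hswap : #{g : Fin n → ZMod 2 × ZMod 2 | g ∈ N ∧ commSign e g = 1}
      = #{g : Fin n → ZMod 2 × ZMod 2 | g ∈ N ∧ ¬ commSign e g = 1} := by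
    refine Finset.card_bij' (fun g _ => g + h) (fun g _ => g + h) ?_ ?_ ?_ ?_
    · simp only [Finset.mem_filter, Finset.mem_univ, true_and]
      rintro g ⟨hg, hg'⟩
      refine ⟨N.add_mem hg hh, ?_⟩
      rw [commSign_add_right, hg', heh']
      norm_num
    · simp only [Finset.mem_filter, Finset.mem_univ, true_and]
      rintro g ⟨hg, hg'⟩
      refine ⟨N.add_mem hg hh, ?_⟩
      rw [commSign_add_right, (commSign_eq_or e g).resolve_left hg', heh']
      norm_num
    · intro g _
      simp [add_assoc, add_self_label]
    · intro g _
      simp [add_assoc, add_self_label]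
  rw [two_mul]
  nth_rewrite 2 [hswap]
  rw [← Finset.filter_filter, ← Finset.filter_filter, Finset.card_filter_add_card_filter_not]

theorem badErrors_commutant_subset (E : Finset (Fin n → ZMod 2 × ZMod 2))
    (N : AddSubgroup (Fin n → ZMod 2 × ZMod 2)) (g : Fin n → ZMod 2 × ZMod 2) :
    open scoped Classical in
      badErrors E (commutant N g) ⊆ {e ∈ badErrors E N | commSign e g = 1} := by
  classical
  intro e he
  simp only [badErrors, Finset.mem_filter, mem_commutant] at he ⊢
  exact ⟨⟨he.1, he.2.1.1, fun hc => he.2.2 ⟨he.2.1, fun u hu => hc.2 u hu.1⟩⟩, he.2.1.2⟩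

theorem exists_two_mul_card_badErrors_commutant_le (E : Finset (Fin n → ZMod 2 × ZMod 2))
    (N : AddSubgroup (Fin n → ZMod 2 × ZMod 2)) :
    ∃ g ∈ N, 2 * #(badErrors E (commutant N g)) ≤ #(badErrors E N) := by
  classical
  by_contra! hlt
  set M : Finset (Fin n → ZMod 2 × ZMod 2) := {g | g ∈ N} with hM
  have hMne : M.Nonempty := ⟨0, by simp [hM, N.zero_mem]⟩
  have h1 : ∑ _g ∈ M, #(badErrors E N) <
      ∑ g ∈ M, 2 * #{e ∈ badErrors E N | commSign e g = 1} := by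
    refine Finset.sum_lt_sum_of_nonempty hMne fun g hg => ?_
    have hgN : g ∈ N := by simpa [hM] using hg
    refine (hlt g hgN).trans_le (Nat.mul_le_mul_left 2 ?_)
    exact Finset.card_le_card (badErrors_commutant_subset E N g)
  have h2 : ∑ g ∈ M, 2 * #{e ∈ badErrors E N | commSign e g = 1}
      = ∑ _e ∈ badErrors E N, #M := by
    rw [← Finset.mul_sum]
    simp only [Finset.card_filter _ (badErrors E N)]
    rw [Finset.sum_comm, Finset.mul_sum]
    refine Finset.sum_congr rfl fun e he => ?_
    simp only [badErrors, Finset.mem_filter, IsCentral, not_and, not_forall] at he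
    obtain ⟨_, heN, hc⟩ := he
    obtain ⟨h, hh, heh⟩ := hc heN
    rw [← Finset.card_filter, hM, Finset.filter_filter]
    exact two_mul_card_commuting N hh heh
  rw [h2, Finset.sum_const, Finset.sum_const, smul_eq_mul, smul_eq_mul, mul_comm] at h1
  exact lt_irrefl _ h1

/-- The subspace `C` behaves like a joint eigenspace of the Pauli operators labelled by the centre
of `N`: operators labelled by `N` preserve it, central ones act on it as scalars, and all
the remaining Pauli operators have zero expectation on it. -/
structure IsStabilized (N : AddSubgroup (Fin n → ZMod 2 × ZMod 2))
    (C : Submodule ℂ ((Fin n → Fin 2) → ℂ)) : Prop where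
  mulVec_mem : ∀ v ∈ N, ∀ ψ ∈ C, pauliOp v *ᵥ ψ ∈ C
  expectation : ∀ v ∉ N, ∀ ψ ∈ C, star ψ ⬝ᵥ (pauliOp v *ᵥ ψ) = 0
  scalar : ∀ v, IsCentral N v → ∃ c : ℂ, ∀ ψ ∈ C, pauliOp v *ᵥ ψ = c • ψ

theorem isStabilized_top :
    IsStabilized (⊤ : AddSubgroup (Fin n → ZMod 2 × ZMod 2)) ⊤ where
  mulVec_mem _ _ _ _ := Submodule.mem_top
  expectation v hv := absurd (AddSubgroup.mem_top v) hv
  scalar v hv := by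
    refine ⟨1, fun ψ _ => ?_⟩
    rw [eq_zero_of_commSign_eq_one fun u => hv.2 u (AddSubgroup.mem_top u), pauliOp_zero,
      Matrix.one_mulVec, one_smul]

theorem expectation_eq_zero {v g : Fin n → ZMod 2 × ZMod 2} (hvg : commSign v g ≠ 1)
    {ε : ℂ} (hε : ε = 1 ∨ ε = -1) {ψ : (Fin n → Fin 2) → ℂ} (hψ : pauliOp g *ᵥ ψ = ε • ψ) :
    star ψ ⬝ᵥ (pauliOp v *ᵥ ψ) = 0 := by
  have hadj : star ψ ⬝ᵥ (pauliOp g *ᵥ (pauliOp v *ᵥ ψ))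
      = star (pauliOp g *ᵥ ψ) ⬝ᵥ (pauliOp v *ᵥ ψ) := by
    rw [Matrix.star_mulVec, conjTranspose_pauliOp, Matrix.dotProduct_mulVec]
  have hcomm : pauliOp g *ᵥ (pauliOp v *ᵥ ψ) = -ε • (pauliOp v *ᵥ ψ) := by
    rw [Matrix.mulVec_mulVec, pauliOp_comm, commSign_comm,
      (commSign_eq_or v g).resolve_left hvg, Matrix.smul_mulVec, ← Matrix.mulVec_mulVec, hψ,
      Matrix.mulVec_smul, smul_smul, neg_one_mul]
  rw [hcomm, hψ, star_smul, smul_dotProduct, dotProduct_smul] at hadj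
  rcases hε with rfl | rfl
  · simp only [smul_eq_mul, star_one] at hadj
    linear_combination (-1 / 2) * hadj
  · simp only [smul_eq_mul, star_neg, star_one] at hadj
    linear_combination (1 / 2) * hadj

/-- The `ε`-eigenspace of the Pauli operator labelled by `g` inside `C`. -/
def eigenpart (C : Submodule ℂ ((Fin n → Fin 2) → ℂ)) (g : Fin n → ZMod 2 × ZMod 2) (ε : ℂ) :
    Submodule ℂ ((Fin n → Fin 2) → ℂ) :=
  C ⊓ Module.End.eigenspace (pauliOp g).mulVecLin ε

theorem mem_eigenpart {C : Submodule ℂ ((Fin n → Fin 2) → ℂ)} {g : Fin n → ZMod 2 × ZMod 2}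
    {ε : ℂ} {ψ : (Fin n → Fin 2) → ℂ} :
    ψ ∈ eigenpart C g ε ↔ ψ ∈ C ∧ pauliOp g *ᵥ ψ = ε • ψ := by
  rw [eigenpart, Submodule.mem_inf, Module.End.mem_eigenspace_iff, Matrix.mulVecLin_apply]

theorem IsStabilized.eigenpart {N : AddSubgroup (Fin n → ZMod 2 × ZMod 2)}
    {C : Submodule ℂ ((Fin n → Fin 2) → ℂ)} (hC : IsStabilized N C)
    {g : Fin n → ZMod 2 × ZMod 2} (hg : g ∈ N) {ε : ℂ} (hε : ε = 1 ∨ ε = -1) :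
    IsStabilized (commutant N g) (eigenpart C g ε) where
  mulVec_mem v hv ψ hψ := by
    rw [mem_eigenpart] at hψ ⊢
    refine ⟨hC.mulVec_mem v hv.1 ψ hψ.1, ?_⟩
    rw [Matrix.mulVec_mulVec, pauliOp_comm, commSign_comm, hv.2, one_smul,
      ← Matrix.mulVec_mulVec, hψ.2, Matrix.mulVec_smul]
  expectation v hv ψ hψ := by
    rw [mem_eigenpart] at hψ
    by_cases hvN : v ∈ N
    · exact expectation_eq_zero (fun h => hv ⟨hvN, h⟩) hε hψ.2
    · exact hC.expectation v hvN ψ hψ.1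
  scalar v hv := by
    rcases hv.of_commutant hg with hc | hc
    · obtain ⟨c, hc⟩ := hC.scalar v hc
      exact ⟨c, fun ψ hψ => hc ψ (mem_eigenpart.mp hψ).1⟩
    · obtain ⟨c, hc⟩ := hC.scalar _ hc
      obtain ⟨a, ha⟩ := exists_pauliOp_add (v + g) g
      rw [add_assoc, add_self_label, add_zero] at ha
      refine ⟨a * (ε * c), fun ψ hψ => ?_⟩
      rw [mem_eigenpart] at hψ
      rw [ha, Matrix.smul_mulVec, ← Matrix.mulVec_mulVec, hψ.2, Matrix.mulVec_smul,
        hc ψ hψ.1, smul_smul, smul_smul, mul_assoc]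

theorem le_eigenpart_sup_eigenpart {C : Submodule ℂ ((Fin n → Fin 2) → ℂ)}
    {g : Fin n → ZMod 2 × ZMod 2} (hg : ∀ ψ ∈ C, pauliOp g *ᵥ ψ ∈ C) :
    C ≤ eigenpart C g 1 ⊔ eigenpart C g (-1) := by
  intro ψ hψ
  have hsq : pauliOp g *ᵥ (pauliOp g *ᵥ ψ) = ψ := by
    rw [Matrix.mulVec_mulVec, pauliOp_mul_self, Matrix.one_mulVec]
  refine Submodule.mem_sup.mpr ⟨(1 / 2 : ℂ) • (ψ + pauliOp g *ᵥ ψ), ?_,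
    (1 / 2 : ℂ) • (ψ - pauliOp g *ᵥ ψ), ?_, ?_⟩
  · refine mem_eigenpart.mpr ⟨C.smul_mem _ (C.add_mem hψ (hg ψ hψ)), ?_⟩
    rw [Matrix.mulVec_smul, Matrix.mulVec_add, hsq, one_smul, add_comm]
  · refine mem_eigenpart.mpr ⟨C.smul_mem _ (C.sub_mem hψ (hg ψ hψ)), ?_⟩
    rw [Matrix.mulVec_smul, Matrix.mulVec_sub, hsq, neg_one_smul, ← smul_neg, neg_sub]
  · rw [← smul_add, add_add_sub_cancel, ← two_smul ℂ ψ, smul_smul]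
    norm_num

theorem IsStabilized.exists_finrank_le_two_mul {N : AddSubgroup (Fin n → ZMod 2 × ZMod 2)}
    {C : Submodule ℂ ((Fin n → Fin 2) → ℂ)} (hC : IsStabilized N C)
    {g : Fin n → ZMod 2 × ZMod 2} (hg : g ∈ N) :
    ∃ C', IsStabilized (commutant N g) C' ∧ Module.finrank ℂ C ≤ 2 * Module.finrank ℂ C' := by
  have h1 := (Submodule.finrank_mono (le_eigenpart_sup_eigenpart (hC.mulVec_mem g hg))).trans
    (Submodule.finrank_add_le_finrank_add_finrank _ _)
  rcases le_total (Module.finrank ℂ (_root_.eigenpart C g 1))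
    (Module.finrank ℂ (_root_.eigenpart C g (-1))) with h | h
  · exact ⟨_, hC.eigenpart hg (Or.inr rfl), by omega⟩
  · exact ⟨_, hC.eigenpart hg (Or.inl rfl), by omega⟩

theorem exists_isStabilized_card_badErrors (E : Finset (Fin n → ZMod 2 × ZMod 2)) (i : ℕ) :
    ∃ N C, IsStabilized N C ∧ 2 ^ n ≤ 2 ^ i * Module.finrank ℂ C ∧
      2 ^ i * #(badErrors E N) ≤ #(badErrors E ⊤) := by
  induction i with
  | zero => exact ⟨⊤, ⊤, isStabilized_top, by simp, by simp⟩
  | succ i ih =>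
    obtain ⟨N, C, hC, hdim, hbad⟩ := ih
    obtain ⟨g, hg, hcard⟩ := exists_two_mul_card_badErrors_commutant_le E N
    obtain ⟨C', hC', hdim'⟩ := hC.exists_finrank_le_two_mul hg
    refine ⟨_, C', hC', hdim.trans ?_, le_trans ?_ hbad⟩
    · rw [pow_succ, mul_assoc]
      exact Nat.mul_le_mul_left _ hdim'
    · rw [pow_succ, mul_assoc]
      exact Nat.mul_le_mul_left _ hcard

theorem card_hammingNorm_eq_le (j : ℕ) :
    #{v : Fin n → ZMod 2 × ZMod 2 | hammingNorm v = j} ≤ 3 ^ j * n.choose j := by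
  classical
  let F (T : Finset (Fin n)) : Finset (Fin n → ZMod 2 × ZMod 2) :=
    Fintype.piFinset fun i => if i ∈ T then {0}ᶜ else {0}
  have hsub : ({v | hammingNorm v = j} : Finset (Fin n → ZMod 2 × ZMod 2)) ⊆
      (Finset.univ.powersetCard j).biUnion F := by
    intro v hv
    simp only [Finset.mem_filter, Finset.mem_univ, true_and] at hv
    rw [Finset.mem_biUnion]
    refine ⟨Finset.univ.filter fun i => v i ≠ 0,
      Finset.mem_powersetCard.mpr ⟨Finset.subset_univ _, hv⟩, ?_⟩
    rw [Fintype.mem_piFinset]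
    intro i
    by_cases h : v i = 0 <;> simp [h]
  have hF : ∀ T ∈ (Finset.univ : Finset (Fin n)).powersetCard j, #(F T) ≤ 3 ^ j := by
    intro T hT
    have h3 : #({0}ᶜ : Finset (ZMod 2 × ZMod 2)) = 3 := by decide
    simp only [F, Fintype.card_piFinset, apply_ite Finset.card, h3, Finset.card_singleton,
      Finset.prod_ite_mem, Finset.univ_inter, Finset.prod_const, (Finset.mem_powersetCard.mp hT).2]
    exact le_rfl
  refine (Finset.card_le_card hsub).trans ((Finset.card_biUnion_le_card_mul _ _ _ hF).trans ?_)
  rw [Finset.card_powersetCard, Finset.card_univ, Fintype.card_fin, mul_comm]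

theorem card_hammingNorm_lt_le (d : ℕ) :
    #{v : Fin n → ZMod 2 × ZMod 2 | hammingNorm v < d} ≤
      ∑ j ∈ Finset.range d, 3 ^ j * n.choose j := by
  classical
  rw [Finset.card_eq_sum_card_fiberwise (f := hammingNorm) (t := Finset.range d)
    (by intro v hv; simpa using hv)]
  refine Finset.sum_le_sum fun j _ => le_trans (Finset.card_le_card ?_) (card_hammingNorm_eq_le j)
  intro v hv
  simp only [Finset.mem_filter, Finset.mem_univ, true_and] at hv ⊢
  exact hv.2

theorem IsPauliOfWeightLE.exists_pauliOp {w : ℕ} {P : MatN n} (hP : IsPauliOfWeightLE n w P) :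
    ∃ (c : ℂ) (v : Fin n → ZMod 2 × ZMod 2), hammingNorm v ≤ w ∧ P = c • pauliOp v := by
  classical
  obtain ⟨c, σ, -, hσ, hw, rfl⟩ := hP
  have hlabel : ∀ j, ∃ p, σ j = pauliMat p ∧ (σ j = 1 → p = 0) := by
    intro j
    by_cases h1 : σ j = 1
    · exact ⟨0, by rw [h1, pauliMat_zero], fun _ => rfl⟩
    · rcases hσ j with h | h | h | h
      · exact absurd h h1
      · exact ⟨(1, 0), by simp [h, pauliMat], fun h' => absurd h' h1⟩
      · exact ⟨(1, 1), by simp [h, pauliMat], fun h' => absurd h' h1⟩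
      · exact ⟨(0, 1), by simp [h, pauliMat], fun h' => absurd h' h1⟩
  choose v hv hv0 using hlabel
  refine ⟨Complex.I ^ c, v, le_trans ?_ hw, ?_⟩
  · rw [Nat.card_eq_fintype_card, Fintype.card_subtype]
    refine Finset.card_le_card fun j hj => ?_
    simp only [Finset.mem_filter, Finset.mem_univ, true_and] at hj ⊢
    exact fun h => hj (hv0 j h)
  · simp only [pauliOp, ← hv]

theorem IsStabilized.exists_expectation_eq {N : AddSubgroup (Fin n → ZMod 2 × ZMod 2)}
    {C : Submodule ℂ ((Fin n → Fin 2) → ℂ)} (hC : IsStabilized N C)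
    {v : Fin n → ZMod 2 × ZMod 2} (hv : v ∈ N → IsCentral N v) :
    ∃ c : ℂ, ∀ ψ ∈ C, star ψ ⬝ᵥ ψ = 1 → star ψ ⬝ᵥ (pauliOp v *ᵥ ψ) = c := by
  by_cases hvN : v ∈ N
  · obtain ⟨c, hc⟩ := hC.scalar v (hv hvN)
    refine ⟨c, fun ψ hψ h1 => ?_⟩
    rw [hc ψ hψ, dotProduct_smul, h1, smul_eq_mul, mul_one]
  · exact ⟨0, fun ψ hψ _ => hC.expectation v hvN ψ hψ⟩

end Labels

/-- **Quantum Gilbert–Varshamov bound.**  If `d ≥ 1` and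
`(∑_{j=0}^{d−1} 3^j (n choose j)) * 2^k ≤ 2^n`, then an `[[n,k,d]]` quantum code
`C ⊆ ℂ^{2^n}` exists. -/
theorem quantum_gilbert_varshamov (n k d : ℕ) (hd : 1 ≤ d)
    (h : (∑ j ∈ Finset.range d, 3 ^ j * n.choose j) * 2 ^ k ≤ 2 ^ n) :
    ∃ C : Submodule ℂ ((Fin n → Fin 2) → ℂ), IsQuantumCode n k d C := by
  classical
  set B := ∑ j ∈ Finset.range d, 3 ^ j * n.choose j with hB
  let E : Finset (Fin n → ZMod 2 × ZMod 2) := {v | hammingNorm v < d}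
  have hlt : #(badErrors E ⊤) < B := by
    refine lt_of_lt_of_le (Finset.card_lt_card ?_) (card_hammingNorm_lt_le d)
    refine Finset.ssubset_iff_subset_ne.mpr ⟨Finset.filter_subset _ _, fun heq => ?_⟩
    have h0 : (0 : Fin n → ZMod 2 × ZMod 2) ∈ badErrors E ⊤ := by
      rw [heq]
      simp only [Finset.mem_filter, Finset.mem_univ, true_and, hammingNorm_zero]
      exact hd
    rw [badErrors, Finset.mem_filter] at h0
    exact h0.2.2 ⟨AddSubgroup.mem_top _, fun u _ => commSign_zero_left u⟩
  have hkn : k ≤ n := by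
    refine (Nat.pow_le_pow_iff_right one_lt_two).mp (le_trans ?_ h)
    exact Nat.le_mul_of_pos_left _ (Nat.zero_lt_of_lt hlt)
  have hpow : 2 ^ n = 2 ^ (n - k) * 2 ^ k := by rw [← pow_add, Nat.sub_add_cancel hkn]
  have hBle : B ≤ 2 ^ (n - k) := by
    rw [hpow] at h
    exact Nat.le_of_mul_le_mul_right h (by positivity)
  obtain ⟨N, C, hC, hdim, hbad⟩ := exists_isStabilized_card_badErrors E (n - k)
  have hempty : badErrors E N = ∅ := by
    rw [← Finset.card_eq_zero]
    by_contra hne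
    have := Nat.le_mul_of_pos_right (2 ^ (n - k)) (Nat.pos_of_ne_zero hne)
    omega
  rw [hpow] at hdim
  obtain ⟨D, hDC, hD⟩ := Submodule.exists_le_finrank_eq
    (Nat.le_of_mul_le_mul_left hdim (by positivity))
  refine ⟨D, hD, fun P hP => ?_⟩
  obtain ⟨a, v, hv, rfl⟩ := hP.exists_pauliOp
  have hcentral : v ∈ N → IsCentral N v := by
    intro hvN
    by_contra hvc
    have hmem : v ∈ badErrors E N := by
      simp only [badErrors, E, Finset.mem_filter, Finset.mem_univ, true_and]
      exact ⟨by omega, hvN, hvc⟩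
    simp [hempty] at hmem
  obtain ⟨c, hc⟩ := hC.exists_expectation_eq hcentral
  refine ⟨a * c, fun ψ hψ h1 => ?_⟩
  rw [Matrix.smul_mulVec, dotProduct_smul, hc ψ (hDC hψ) h1, smul_eq_mul]

end
end

section
/- Hadamard transform of a coset superposition (CSS duality): Let D be a ZMod 2-linear subspace of (ZMod 2)^n, let D^⊥ = {v : v·w = 0 for all w ∈ D} be its dual, and let u ∈ (ZMod 2)^n. In ℂ^{((ZMod 2)^n)}, with standard basis vectors e_x, the n-fold Kronecker power of the Hadamard matrix H = (1/√2)·!![1,1;1,−1] satisfies H^{⊗n} ( ∑_{w ∈ D} e_{u+w} ) = 2^{−n/2} · |D| · ∑_{v ∈ D^⊥} (−1)^{u·v} e_v, where u·v is the dot product in ZMod 2 lifted to {0,1}. -/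
open Finset

noncomputable section

/-- The `n`-fold Kronecker power of the Hadamard matrix `H = (1/√2)·!![1,1;1,−1]`, acting
on `ℂ^{((ZMod 2)^n)}` by `(H^{⊗n})_{v,x} = 2^{−n/2} (−1)^{v·x}`. -/
def Hmat (n : ℕ) : Matrix (Fin n → ZMod 2) (Fin n → ZMod 2) ℂ :=
  Matrix.of fun v x =>
    ((Real.sqrt 2 : ℂ))⁻¹ ^ n * (-1 : ℂ) ^ (∑ j, v j * x j).val

/-- The standard basis vector `e_x` of `ℂ^{((ZMod 2)^n)}`. -/
def stdBasisVec {n : ℕ} (x : Fin n → ZMod 2) : (Fin n → ZMod 2) → ℂ :=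
  Pi.single x 1

theorem neg_one_pow_val_add (a b : ZMod 2) :
    (-1 : ℂ) ^ (a + b).val = (-1) ^ a.val * (-1) ^ b.val := by
  rw [ZMod.val_add, ← pow_add, ← neg_one_pow_eq_pow_mod_two]

theorem neg_one_pow_val_of_ne_zero {a : ZMod 2} (ha : a ≠ 0) :
    (-1 : ℂ) ^ a.val = -1 := by
  have h : a = 1 := by
    revert ha
    revert a
    decide
  subst h
  simp [ZMod.val_one]

/-- Character orthogonality on a subspace of `(ZMod 2)^n`. -/
theorem sum_submodule_neg_one_pow_dot {n : ℕ} (D : Submodule (ZMod 2) (Fin n → ZMod 2))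
    [Fintype D] (v : Fin n → ZMod 2) [Decidable (∀ w ∈ D, ∑ j, v j * w j = 0)] :
    ∑ w : D, (-1 : ℂ) ^ (∑ j, v j * w.1 j).val =
      if ∀ w ∈ D, ∑ j, v j * w j = 0 then (Nat.card D : ℂ) else 0 := by
  split_ifs with h
  · simp [fun w : D => h w.1 w.2]
  · push Not at h
    obtain ⟨w₀, hw₀, hne⟩ := h
    have key := Fintype.sum_equiv (Equiv.addRight (⟨w₀, hw₀⟩ : D))
      (fun w : D => -(-1 : ℂ) ^ (∑ j, v j * w.1 j).val)
      (fun w : D => (-1 : ℂ) ^ (∑ j, v j * w.1 j).val) (fun w => by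
        simp [mul_add, sum_add_distrib, neg_one_pow_val_add, neg_one_pow_val_of_ne_zero hne])
    rw [sum_neg_distrib] at key
    exact self_eq_neg.mp key.symm

theorem Hmat_mulVec_stdBasisVec {n : ℕ} (x v : Fin n → ZMod 2) :
    (Hmat n).mulVec (stdBasisVec x) v =
      ((Real.sqrt 2 : ℂ))⁻¹ ^ n * (-1 : ℂ) ^ (∑ j, v j * x j).val := by
  simp [stdBasisVec, Hmat]

/-- **Hadamard transform of a coset superposition (CSS duality).**  For a linear subspace
`D ⊆ (ZMod 2)^n` with dual `D^⊥ = {v : v·w = 0 ∀ w ∈ D}` and any `u ∈ (ZMod 2)^n`,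
`H^{⊗n} (∑_{w ∈ D} e_{u+w}) = 2^{−n/2} |D| ∑_{v ∈ D^⊥} (−1)^{u·v} e_v`. -/
theorem hadamard_coset (n : ℕ) (D : Submodule (ZMod 2) (Fin n → ZMod 2))
    (u : Fin n → ZMod 2) :
    (Hmat n).mulVec (∑ᶠ w ∈ (D : Set (Fin n → ZMod 2)), stdBasisVec (u + w)) =
      (((Real.sqrt 2 : ℂ))⁻¹ ^ n * (Nat.card D : ℂ)) •
        ∑ᶠ v ∈ {v : Fin n → ZMod 2 | ∀ w ∈ D, ∑ j, v j * w j = 0},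
          ((-1 : ℂ) ^ (∑ j, u j * v j).val • stdBasisVec v) := by
  classical
  have hD : ∑ᶠ w ∈ (D : Set (Fin n → ZMod 2)), stdBasisVec (u + w) =
      ∑ w : D, stdBasisVec (u + w.1) := by
    rw [← finsum_eq_sum_of_fintype]
    exact (finsum_set_coe_eq_finsum_mem (D : Set (Fin n → ZMod 2))).symm
  have hdual : ∑ᶠ v ∈ {v : Fin n → ZMod 2 | ∀ w ∈ D, ∑ j, v j * w j = 0},
        ((-1 : ℂ) ^ (∑ j, u j * v j).val • stdBasisVec v) =
      ∑ v, if ∀ w ∈ D, ∑ j, v j * w j = 0 then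
        ((-1 : ℂ) ^ (∑ j, u j * v j).val • stdBasisVec v) else 0 := by
    rw [← finsum_eq_sum_of_fintype]
    simp only [Set.mem_ofPred_eq, finsum_eq_if]
  rw [hD, hdual, Matrix.mulVec_sum]
  ext v
  have hcoord : (∑ x, if ∀ w ∈ D, ∑ j, x j * w j = 0 then
        ((-1 : ℂ) ^ (∑ j, u j * x j).val • stdBasisVec x) else 0) v =
      if ∀ w ∈ D, ∑ j, v j * w j = 0 then (-1 : ℂ) ^ (∑ j, u j * v j).val else 0 := by
    rw [Finset.sum_apply, Finset.sum_eq_single v]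
    · split_ifs <;> simp [stdBasisVec]
    · intro x _ hx
      split_ifs <;> simp [stdBasisVec, hx.symm]
    · simp
  rw [Pi.smul_apply, hcoord, Finset.sum_apply]
  simp only [Hmat_mulVec_stdBasisVec, Pi.add_apply, mul_add, sum_add_distrib,
    neg_one_pow_val_add]
  rw [← mul_sum, ← mul_sum, sum_submodule_neg_one_pow_dot]
  simp only [smul_eq_mul, mul_comm (u _)]
  split_ifs
  · ring
  · simp

end
end

section
/- Hadamard transform of cat states: Let n ≥ 1. In ℂ^{((ZMod 2)^n)}, with standard basis vectors e_x, let 0⃗ and 1⃗ denote the all-zeros and all-ones vectors. Then H^{⊗n}(e_{0⃗} + e_{1⃗}) = 2^{1−n/2} · ∑_{x : ∑_j x_j = 0} e_x and H^{⊗n}(e_{0⃗} − e_{1⃗}) = 2^{1−n/2} · ∑_{x : ∑_j x_j = 1} e_x, where ∑_j x_j is computed in ZMod 2; i.e. the transforms are (up to normalization) the uniform superpositions over even-weight and odd-weight bit strings respectively. -/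
open Finset

noncomputable section

/-- **Hadamard transform of cat states.**  For `n ≥ 1`,
`H^{⊗n}(e_{0⃗} + e_{1⃗}) = 2^{1−n/2} ∑_{parity x = 0} e_x` and
`H^{⊗n}(e_{0⃗} − e_{1⃗}) = 2^{1−n/2} ∑_{parity x = 1} e_x`: the transforms are, up to
normalization, the uniform superpositions over even-weight and odd-weight bit strings. -/
theorem hadamard_cat (n : ℕ) (hn : 1 ≤ n) :
    ((Hmat n).mulVec
        (Pi.single (0 : Fin n → ZMod 2) (1 : ℂ) + Pi.single (fun _ => 1) (1 : ℂ)) =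
      (2 * ((Real.sqrt 2 : ℂ))⁻¹ ^ n) •
        ∑ x ∈ Finset.univ.filter (fun x : Fin n → ZMod 2 => (∑ j, x j) = 0),
          Pi.single x (1 : ℂ)) ∧
    ((Hmat n).mulVec
        (Pi.single (0 : Fin n → ZMod 2) (1 : ℂ) - Pi.single (fun _ => 1) (1 : ℂ)) =
      (2 * ((Real.sqrt 2 : ℂ))⁻¹ ^ n) •
        ∑ x ∈ Finset.univ.filter (fun x : Fin n → ZMod 2 => (∑ j, x j) = 1),
          Pi.single x (1 : ℂ)) := by
  have h (a : ZMod 2) : a = 0 ∨ a = 1 := by revert a; decide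
  have key (x : Fin n → ZMod 2) (p : ZMod 2) :
      (∑ y ∈ Finset.univ.filter (fun y : Fin n → ZMod 2 => (∑ j, y j) = p),
        Pi.single y (1 : ℂ) : (Fin n → ZMod 2) → ℂ) x = if (∑ j, x j) = p then 1 else 0 := by
    simp [Finset.sum_apply, Pi.single_apply]
  constructor <;> ext x <;>
    simp only [Matrix.mulVec_add, Matrix.mulVec_sub, Matrix.mulVec_single_one, Pi.add_apply,
      Pi.sub_apply, Pi.smul_apply, key, Matrix.col_apply, Hmat, Matrix.of_apply, Pi.zero_apply,
      mul_zero, mul_one, Finset.sum_const_zero, ZMod.val_zero, pow_zero, smul_eq_mul] <;>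
    rcases h (∑ j, x j) with hx | hx <;> simp [hx, ZMod.val_one] <;> ring

end
end

section
/- Doubly-exponential error suppression under concatenation: Let t ≥ 1 be a natural number, A > 0 a real number, and set p_T = A^{−1/t}. Let p : ℕ → ℝ be a sequence with p(j) ≥ 0 for all j and p(j+1) ≤ A · p(j)^{t+1} for all j. Then for every j, p(j) ≤ p_T · (p(0)/p_T)^{(t+1)^j}. In particular, if p(0) < p_T then p(j) → 0 doubly exponentially in j. -/
/-- The threshold `A ^ (-1 / t)` is the scale `c` with `A * c ^ t = 1`. -/
theorem mul_rpow_neg_one_div_pow {A : ℝ} (hA : 0 < A) {t : ℕ} (ht : t ≠ 0) :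
    A * (A ^ (-(1 : ℝ) / t)) ^ t = 1 := by
  rw [← Real.rpow_mul_natCast hA.le, div_mul_cancel₀ _ (Nat.cast_ne_zero.mpr ht),
    Real.rpow_neg_one, mul_inv_cancel₀ hA.ne']

theorem le_mul_div_pow_pow_of_succ_le {A c : ℝ} {t : ℕ} {p : ℕ → ℝ} (hA : 0 ≤ A) (hc : c ≠ 0)
    (hAc : A * c ^ t = 1) (hp : ∀ j, 0 ≤ p j) (hrec : ∀ j, p (j + 1) ≤ A * p j ^ (t + 1))
    (j : ℕ) : p j ≤ c * (p 0 / c) ^ ((t + 1) ^ j) := by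
  induction j with
  | zero => simp [mul_div_cancel₀ _ hc]
  | succ j ih =>
    calc p (j + 1) ≤ A * p j ^ (t + 1) := hrec j
      _ ≤ A * (c * (p 0 / c) ^ ((t + 1) ^ j)) ^ (t + 1) := by gcongr; exact hp j
      _ = A * c ^ t * (c * (p 0 / c) ^ ((t + 1) ^ (j + 1))) := by
        rw [mul_pow, ← pow_mul, ← pow_succ, pow_succ c]
        ring
      _ = c * (p 0 / c) ^ ((t + 1) ^ (j + 1)) := by rw [hAc, one_mul]

/-- **Doubly-exponential error suppression under concatenation.**  Let `t ≥ 1`, `A > 0`,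
and set `p_T = A^(-1/t)`.  If `p : ℕ → ℝ` is nonnegative and satisfies
`p (j+1) ≤ A * p j ^ (t+1)` for all `j`, then `p j ≤ p_T * (p 0 / p_T) ^ ((t+1)^j)` for
every `j`; in particular, if `p 0 < p_T` then `p j → 0`. -/
theorem concatenation_error_suppression (t : ℕ) (ht : 1 ≤ t) (A : ℝ) (hA : 0 < A)
    (p : ℕ → ℝ) (hp : ∀ j, 0 ≤ p j)
    (hrec : ∀ j, p (j + 1) ≤ A * p j ^ (t + 1)) :
    (∀ j, p j ≤ A ^ (-(1 : ℝ) / t) * (p 0 / A ^ (-(1 : ℝ) / t)) ^ ((t + 1) ^ j)) ∧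
    (p 0 < A ^ (-(1 : ℝ) / t) → Filter.Tendsto p Filter.atTop (nhds 0)) := by
  have hc : 0 < A ^ (-(1 : ℝ) / t) := Real.rpow_pos_of_pos hA _
  have hbound := le_mul_div_pow_pow_of_succ_le hA.le hc.ne'
    (mul_rpow_neg_one_div_pow hA (by lia)) hp hrec
  refine ⟨hbound, fun h0 => squeeze_zero hp hbound ?_⟩
  have hexp : Filter.Tendsto (fun j : ℕ => (t + 1) ^ j) Filter.atTop Filter.atTop :=
    tendsto_pow_atTop_atTop_of_one_lt (by lia)
  simpa using ((tendsto_pow_atTop_nhds_zero_of_lt_one (div_nonneg (hp 0) hc.le)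
    ((div_lt_one hc).mpr h0)).comp hexp).const_mul (A ^ (-(1 : ℝ) / t))
end
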